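/- Simulation of τ-closure: for every automaton M, if regular_ta M then tau_sim M (tauclose_ta M); i.e., every well-formed automaton is simulated by its τ-closure (a witnessing relation is R s s' ⟺ s ∈ set (nodes M) ∧ s' ∈ set (nodes (tauclose_ta M)) ∧ s ∈ s'). -/

import Mathlib

/-! Automata with a background state, actions, and τ-closure. -/

abbrev vname := String

inductive val where
  | Bool : Bool → val
  | Null : val
deriving DecidableEq

inductive action where
  | NoAct : action
  | AssAct : vname → val → action
deriving DecidableEq

structure edge (n : Type) where
  source : n
  action : action
  dest : n
deriving DecidableEq

structure ta (n : Type) where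
  nodes : List n
  edges : List (edge n)
  init_s : n

/-- One step of the τ-closure computation: add `s` and all nodes reachable from
`x` by one silent transition. -/
def tauclose_step {n : Type} (M : ta n) (s : n) (x : Set n) : Set n :=
  {s} ∪ x ∪ {nd | nd ∈ M.nodes ∧
    ∃ e ∈ M.edges, e.source ∈ x ∧ e.action = action.NoAct ∧ e.dest = nd}

lemma mono_tauclose_step {n : Type} (M : ta n) (s : n) :
    Monotone (tauclose_step M s) := by
  intro x y hxy
  rintro nd (h | ⟨hnd, e, he, hsrc, hact, hdst⟩)
  · exact Or.inl (by rcases h with h | h; exact Or.inl h; exact Or.inr (hxy h))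
  · exact Or.inr ⟨hnd, e, he, hxy hsrc, hact, hdst⟩

/-- The τ-closure of a node: least fixpoint of `tauclose_step`. -/
def tauclose {n : Type} (M : ta n) (s : n) : Set n :=
  OrderHom.lfp ⟨tauclose_step M s, mono_tauclose_step M s⟩

def acts_of_ta {n : Type} (M : ta n) : List action :=
  M.edges.map (fun e => e.action)

/-- Candidate edges of the τ-closed automaton. -/
noncomputable def possible_tau_edges {n : Type} (M : ta n) : List (edge (Set n)) :=
  (M.nodes.product ((acts_of_ta M).product M.nodes)).map
    (fun p => ⟨tauclose M p.1, p.2.1, tauclose M p.2.2⟩)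

open Classical in
/-- Edges of the τ-closed automaton. -/
noncomputable def tauclose_edges {n : Type} (M : ta n) : List (edge (Set n)) :=
  (possible_tau_edges M).filter
    (fun e => decide (∃ s1 a s2,
      e = (⟨tauclose M s1, a, tauclose M s2⟩ : edge (Set n)) ∧
      a ≠ action.NoAct ∧
      ∃ s ∈ tauclose M s1, (⟨s, a, s2⟩ : edge n) ∈ M.edges))

/-- The τ-closed automaton. -/
noncomputable def tauclose_ta {n : Type} (M : ta n) : ta (Set n) :=
  ⟨M.nodes.map (tauclose M), tauclose_edges M, tauclose M M.init_s⟩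

/-- Simulation of automaton `M1` by automaton `M2`. -/
def tau_sim {n1 n2 : Type} (M1 : ta n1) (M2 : ta n2) : Prop :=
  ∃ R : n1 → n2 → Prop,
    R M1.init_s M2.init_s ∧
    ∀ s1 s2, R s1 s2 →
      ∀ s1' a, (⟨s1, a, s1'⟩ : edge n1) ∈ M1.edges →
        (a = action.NoAct ∧ R s1' s2) ∨
        (∃ s2', (⟨s2, a, s2'⟩ : edge n2) ∈ M2.edges ∧ R s1' s2')

/-- Well-formedness of an automaton. -/
def regular_ta {n : Type} (M : ta n) : Prop :=
  M.init_s ∈ M.nodes ∧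
  ∀ e ∈ M.edges, e.source ∈ M.nodes ∧ e.dest ∈ M.nodes

theorem tauclose_step_tauclose {n : Type} (M : ta n) (s : n) :
    tauclose_step M s (tauclose M s) = tauclose M s :=
  OrderHom.map_lfp ⟨tauclose_step M s, mono_tauclose_step M s⟩

theorem self_mem_tauclose {n : Type} (M : ta n) (s : n) : s ∈ tauclose M s := by
  rw [← tauclose_step_tauclose]
  exact Or.inl (Or.inl rfl)

theorem mem_tauclose_of_noAct {n : Type} {M : ta n} (h : regular_ta M) {s x y : n}
    (hx : x ∈ tauclose M s) (he : (⟨x, action.NoAct, y⟩ : edge n) ∈ M.edges) :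
    y ∈ tauclose M s := by
  rw [← tauclose_step_tauclose]
  exact Or.inr ⟨(h.2 _ he).2, _, he, hx, rfl, rfl⟩

open Classical in
theorem mem_edges_tauclose_ta {n : Type} {M : ta n} (h : regular_ta M) {s x y : n} {a : action}
    (hs : s ∈ M.nodes) (hx : x ∈ tauclose M s) (ha : a ≠ action.NoAct)
    (he : (⟨x, a, y⟩ : edge n) ∈ M.edges) :
    (⟨tauclose M s, a, tauclose M y⟩ : edge (Set n)) ∈ (tauclose_ta M).edges := by
  refine List.mem_filter.mpr ⟨List.mem_map.mpr ⟨(s, a, y), ?_, rfl⟩,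
    decide_eq_true ⟨s, a, y, rfl, ha, x, hx, he⟩⟩
  exact List.mem_product.mpr ⟨hs, List.mem_product.mpr
    ⟨List.mem_map.mpr ⟨_, he, rfl⟩, (h.2 _ he).2⟩⟩

/-- Simulation of τ-closure: every well-formed automaton is
simulated by its τ-closure. -/
theorem sim_tauclose_ta {n : Type} (M : ta n) (h : regular_ta M) :
    tau_sim M (tauclose_ta M) := by
  refine ⟨fun s t => s ∈ M.nodes ∧ t ∈ (tauclose_ta M).nodes ∧ s ∈ t,
    ⟨h.1, List.mem_map_of_mem h.1, self_mem_tauclose M _⟩, ?_⟩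
  rintro s t ⟨-, ht, hst⟩ s' a he
  have hs' : s' ∈ M.nodes := (h.2 _ he).2
  obtain ⟨u, hu, rfl⟩ := List.mem_map.mp ht
  by_cases ha : a = action.NoAct
  · subst ha
    exact Or.inl ⟨rfl, hs', ht, mem_tauclose_of_noAct h hst he⟩
  · exact Or.inr ⟨tauclose M s', mem_edges_tauclose_ta h hu hst ha he,
      hs', List.mem_map_of_mem hs', self_mem_tauclose M s'⟩
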